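/- Let R be a Cohen-Macaulay commutative Noetherian ring. Then a nonzero proper radical ideal a of R is a linked ideal if and only if a is unmixed, i.e. all associated primes of R/a have the same height. -/

import Mathlib

/-- `I` is generated by an `R`-regular sequence. -/
def Ideal.IsGenByRegularSequence {R : Type*} [CommRing R] (I : Ideal R) : Prop :=
  ∃ rs : List R, RingTheory.Sequence.IsRegular R rs ∧ I = Ideal.ofList rs

/-- The (proper, nonzero) ideals `a` and `b` are linked by the ideal `I`:
`I` is generated by an `R`-regular sequence, `I ⊆ a ∩ b`, `a = I :_R b` and `b = I :_R a`. -/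
def LinkedBy {R : Type*} [CommRing R] (a b I : Ideal R) : Prop :=
  a ≠ ⊥ ∧ a ≠ ⊤ ∧ b ≠ ⊥ ∧ b ≠ ⊤ ∧ I ≤ a ⊓ b ∧
    Ideal.IsGenByRegularSequence I ∧
    a = Submodule.colon I b ∧ b = Submodule.colon I a

/-- `a` is a linked ideal: it is linked by some ideal `I` to some ideal `b`. -/
def IsLinkedIdeal {R : Type*} [CommRing R] (a : Ideal R) : Prop :=
  ∃ I b : Ideal R, LinkedBy a b I

/-- The depth of a local ring `R`: the supremum of lengths of `R`-regular sequences contained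
in the maximal ideal. -/
noncomputable def ringDepth (R : Type*) [CommRing R] [IsLocalRing R] : ℕ∞ :=
  sSup {n : ℕ∞ | ∃ rs : List R, (rs.length : ℕ∞) = n ∧
    (∀ x ∈ rs, x ∈ IsLocalRing.maximalIdeal R) ∧ RingTheory.Sequence.IsRegular R rs}

/-- A local ring is Cohen–Macaulay if its depth equals its Krull dimension. -/
def IsCohenMacaulayLocalRing (R : Type*) [CommRing R] [IsLocalRing R] : Prop :=
  ringKrullDim R = (ringDepth R : WithBot ℕ∞)

/-- A ring is Cohen–Macaulay if its localization at every prime ideal is a Cohen–Macaulay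
local ring. -/
def IsCohenMacaulayRing (R : Type*) [CommRing R] : Prop :=
  ∀ (p : Ideal R) (hp : p.IsPrime),
    letI := hp
    IsCohenMacaulayLocalRing (Localization.AtPrime p)

open RingTheory.Sequence CategoryTheory Abelian

universe u

namespace ModuleCat

theorem subsingleton_hom_quotient_of_isWeaklyRegular {A : Type u} [CommRing A]
    (N : ModuleCat.{u} A) (rs : List A) (M : ModuleCat.{u} A) (reg : IsWeaklyRegular M rs)
    (h_ext : ∀ i < rs.length + 1, Subsingleton (Ext N M i)) :
    Subsingleton (N →ₗ[A] (M ⧸ (Ideal.ofList rs • ⊤ : Submodule A M))) := by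
  induction rs generalizing M with
  | nil =>
    have := h_ext 0 (by simp)
    have : Subsingleton (N →ₗ[A] M) :=
      (Ext.addEquiv₀.trans ModuleCat.homAddEquiv).symm.subsingleton
    let e : (M ⧸ (Ideal.ofList ([] : List A) • ⊤ : Submodule A M)) ≃ₗ[A] M :=
      Submodule.quotEquivOfEqBot _ (by simp)
    exact (LinearEquiv.congrRight (M := N) e).toEquiv.subsingleton
  | cons x rs ih =>
    rw [isWeaklyRegular_cons_iff] at reg
    have := ih (ModuleCat.of A (QuotSMulTop x M)) reg.2 fun i hi ↦ by
      have zero1 := AddCommGrpCat.isZero_of_iff_subsingleton.mpr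
        (h_ext i (by simp only [List.length_cons]; omega))
      have zero2 := AddCommGrpCat.isZero_of_iff_subsingleton.mpr
        (h_ext (i + 1) (by simp only [List.length_cons]; omega))
      exact AddCommGrpCat.subsingleton_of_isZero <| ShortComplex.Exact.isZero_of_both_zeros
        ((Ext.covariant_sequence_exact₃' N reg.1.smulShortComplex_shortExact) i (i + 1) rfl)
        (zero1.eq_zero_of_src _) (zero2.eq_zero_of_tgt _)
    exact (LinearEquiv.congrRight (M := N)
      (Submodule.quotOfListConsSMulTopEquivQuotSMulTopInner M x rs)).toEquiv.subsingleton

end ModuleCat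

theorem IsLocalRing.length_le_length_of_isRegular {A : Type u} [CommRing A] [IsNoetherianRing A]
    [IsLocalRing A] {xs ys : List A} (hxs : IsRegular A xs)
    (hxm : ∀ x ∈ xs, x ∈ maximalIdeal A) (hys : IsWeaklyRegular A ys) {z : A}
    (hz : z ∉ Ideal.ofList ys) (hmz : ∀ r ∈ maximalIdeal A, r * z ∈ Ideal.ofList ys) :
    xs.length ≤ ys.length := by
  by_contra! hlt
  have h_ext := ModuleCat.subsingleton_ext_of_exists_isRegular (maximalIdeal A)
    (ModuleCat.of A (A ⧸ maximalIdeal A))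
    (by rw [Module.support_eq_zeroLocus, Ideal.annihilator_quotient]) (ModuleCat.of A A)
    (by simpa using! (maximalIdeal.isMaximal A).ne_top.lt_top) xs hxm hxs
  have := ModuleCat.subsingleton_hom_quotient_of_isWeaklyRegular _ ys (ModuleCat.of A A) hys
    fun i hi ↦ h_ext i (by omega)
  let Y : Submodule A A := Ideal.ofList ys • ⊤
  have hY : Y = Ideal.ofList ys := by simp [Y]
  let f : (A ⧸ maximalIdeal A) →ₗ[A] A ⧸ Y :=
    (maximalIdeal A).liftQ (LinearMap.toSpanSingleton A (A ⧸ Y) (Y.mkQ z)) fun r hr ↦ by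
      rw [LinearMap.mem_ker, LinearMap.toSpanSingleton_apply, ← map_smul, Submodule.mkQ_apply,
        Submodule.Quotient.mk_eq_zero, hY]
      exact hmz r hr
  have hf : f = 0 := this.elim f 0
  apply hz
  have := LinearMap.congr_fun hf (Submodule.Quotient.mk 1)
  rw [Submodule.liftQ_apply, LinearMap.toSpanSingleton_apply, one_smul, LinearMap.zero_apply,
    Submodule.mkQ_apply, Submodule.Quotient.mk_eq_zero, hY] at this
  exact this

theorem Ideal.mem_associatedPrimes_quotient_iff {R : Type*} [CommRing R] [IsNoetherianRing R]
    {I Q : Ideal R} :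
    Q ∈ associatedPrimes R (R ⧸ I) ↔ Q.IsPrime ∧ ∃ y, ∀ r, r ∈ Q ↔ r * y ∈ I := by
  rw [AssociatedPrimes.mem_iff, isAssociatedPrime_iff, and_congr_right_iff,
    Ideal.Quotient.mk_surjective.exists]
  refine fun _ ↦ exists_congr fun y ↦ ?_
  rw [SetLike.ext_iff]
  refine forall_congr' fun r ↦ ?_
  rw [Submodule.mem_colon_singleton, Submodule.mem_bot, Algebra.smul_def,
    Ideal.Quotient.algebraMap_eq, ← map_mul, Ideal.Quotient.eq_zero_iff_mem]

theorem Ideal.IsPrime.length_le_height_of_isWeaklyRegular {R : Type*} [CommRing R]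
    [IsNoetherianRing R] {P : Ideal R} (hP : P.IsPrime) {rs : List R}
    (reg : IsWeaklyRegular R rs) (hle : Ideal.ofList rs ≤ P) : (rs.length : ℕ∞) ≤ P.height := by
  have hreg := reg.isRegular_of_isLocalization_of_mem (Localization.AtPrime P) P
    fun r hr ↦ hle (Ideal.subset_span hr)
  have hdim := ringKrullDim_add_length_eq_ringKrullDim_of_isRegular _ hreg
  have : Nontrivial (Localization.AtPrime P ⧸
      Ideal.ofList (rs.map (algebraMap R (Localization.AtPrime P)))) := by
    rw [Ideal.Quotient.nontrivial_iff]
    simpa [eq_comm] using hreg.top_ne_smul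
  rw [IsLocalization.AtPrime.ringKrullDim_eq_height P (Localization.AtPrime P), List.length_map] at hdim
  have h0 := ringKrullDim_nonneg_of_nontrivial (R := Localization.AtPrime P ⧸
      Ideal.ofList (rs.map (algebraMap R (Localization.AtPrime P))))
  have : ((rs.length : ℕ∞) : WithBot ℕ∞) ≤ (P.height : WithBot ℕ∞) := by
    rw [← hdim]
    simpa using add_le_add_left h0 (rs.length : WithBot ℕ∞)
  exact_mod_cast this

theorem IsCohenMacaulayRing.height_eq_length_of_mem_associatedPrimes {R : Type*} [CommRing R]
    [IsNoetherianRing R] (hCM : IsCohenMacaulayRing R) {rs : List R} (reg : IsWeaklyRegular R rs)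
    {Q : Ideal R} (hQ : Q ∈ associatedPrimes R (R ⧸ Ideal.ofList rs)) :
    Q.height = rs.length := by
  obtain ⟨hp, y, hy⟩ := Ideal.mem_associatedPrimes_quotient_iff.mp hQ
  have hle : Ideal.ofList rs ≤ Q := fun r hr ↦ (hy r).mpr (Ideal.mul_mem_right _ _ hr)
  refine le_antisymm ?_ (hp.length_le_height_of_isWeaklyRegular reg hle)
  have hdepth : ringDepth (Localization.AtPrime Q) ≤ rs.length := by
    refine sSup_le ?_
    rintro _ ⟨xs, rfl, hxm, hxs⟩
    have := IsLocalRing.length_le_length_of_isRegular hxs hxm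
      (reg.of_isLocalization (Localization.AtPrime Q) Q.primeCompl)
      (z := algebraMap R (Localization.AtPrime Q) y) ?_ ?_
    · rw [List.length_map] at this
      exact_mod_cast this
    · rw [← Ideal.map_ofList, IsLocalization.algebraMap_mem_map_algebraMap_iff Q.primeCompl]
      rintro ⟨s, hs, hsy⟩
      exact hs ((hy s).mpr hsy)
    · intro r hr
      rw [← Localization.AtPrime.map_eq_maximalIdeal] at hr
      rw [← Ideal.map_ofList]
      induction hr using Submodule.span_induction with
      | mem x hx =>
        obtain ⟨q, hq, rfl⟩ := hx
        rw [← map_mul]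
        exact Ideal.mem_map_of_mem _ ((hy q).mp hq)
      | zero => simp
      | add a b _ _ ha hb => rw [add_mul]; exact Ideal.add_mem _ ha hb
      | smul c a _ ha => rw [smul_eq_mul, mul_assoc]; exact Ideal.mul_mem_left _ _ ha
  have hdim : ringKrullDim (Localization.AtPrime Q) = ringDepth (Localization.AtPrime Q) :=
    hCM Q hp
  rw [IsLocalization.AtPrime.ringKrullDim_eq_height Q, WithBot.coe_inj] at hdim
  rwa [hdim]

theorem RingTheory.Sequence.IsWeaklyRegular.isRegular_of_ofList_ne_top {R : Type*} [CommRing R]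
    {rs : List R} (reg : IsWeaklyRegular R rs) (h : Ideal.ofList rs ≠ ⊤) : IsRegular R rs :=
  ⟨reg, by simpa using h.symm⟩

theorem IsCohenMacaulayRing.exists_isWeaklyRegular {R : Type*} [CommRing R] [IsNoetherianRing R]
    (hCM : IsCohenMacaulayRing R) {a : Ideal R} {n : ℕ}
    (hn : ∀ Q : Ideal R, Q.IsPrime → a ≤ Q → n ≤ Q.height) :
    ∃ rs : List R, rs.length = n ∧ Ideal.ofList rs ≤ a ∧ IsWeaklyRegular R rs := by
  suffices ∀ m ≤ n, ∃ rs : List R, rs.length = m ∧ Ideal.ofList rs ≤ a ∧ IsWeaklyRegular R rs from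
    this n le_rfl
  intro m hm
  induction m with
  | zero => exact ⟨[], by simp⟩
  | succ m ih =>
    obtain ⟨rs, hlen, hle, reg⟩ := ih (by omega)
    let J : Ideal R := Ideal.ofList rs • ⊤
    have hJ : J = Ideal.ofList rs := by simp [J]
    obtain ⟨x, hxa, hx⟩ : ∃ x ∈ a, ∀ p ∈ associatedPrimes R (R ⧸ J), x ∉ p := by
      by_contra! h
      obtain ⟨Q, hQ, haQ⟩ := (Ideal.subset_union_prime_finite
        (associatedPrimes.finite R (R ⧸ J)) (f := id) 0 0 fun _ h _ _ ↦ h.isPrime).mp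
        (fun x hx ↦ by simpa using h x hx)
      have h1 := hn Q hQ.isPrime haQ
      rw [hJ] at hQ
      rw [hCM.height_eq_length_of_mem_associatedPrimes reg hQ, hlen] at h1
      have : n ≤ m := by exact_mod_cast h1
      omega
    refine ⟨rs ++ [x], by simp [hlen], ?_, ?_⟩
    · rw [Ideal.ofList_append, Ideal.ofList_singleton]
      exact sup_le hle ((Ideal.span_singleton_le_iff_mem a).mpr hxa)
    · rw [isWeaklyRegular_append_iff, isWeaklyRegular_singleton_iff]
      refine ⟨reg, isSMulRegular_iff_right_eq_zero_of_smul.mpr fun y hy ↦ ?_⟩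
      by_contra hy0
      have : x ∈ ⋃ p ∈ associatedPrimes R (R ⧸ J), (p : Set R) := by
        rw [biUnion_associatedPrimes_eq_zero_divisors]
        exact ⟨y, hy0, hy⟩
      simp only [Set.mem_iUnion] at this
      obtain ⟨p, hp, hxp⟩ := this
      exact hx p hp hxp

/-- A proper ideal containing a regular sequence also contains one of the same length that does
not generate it. -/
theorem RingTheory.Sequence.IsWeaklyRegular.exists_ofList_ne {R : Type*} [CommRing R]
    {rs : List R} (reg : IsWeaklyRegular R rs) {a : Ideal R} (hle : Ideal.ofList rs ≤ a)
    (ha0 : a ≠ ⊥) (ha1 : a ≠ ⊤) :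
    ∃ ss : List R, ss.length = rs.length ∧ Ideal.ofList ss ≤ a ∧ IsWeaklyRegular R ss ∧
      Ideal.ofList ss ≠ a := by
  rcases rs.eq_nil_or_concat' with rfl | ⟨ys, x, rfl⟩
  · exact ⟨[], by simp, by simp, reg, by simpa using ha0.symm⟩
  rw [Ideal.ofList_append, Ideal.ofList_singleton, sup_le_iff,
    Ideal.span_singleton_le_iff_mem] at hle
  rw [isWeaklyRegular_append_iff, isWeaklyRegular_singleton_iff] at reg
  refine ⟨ys ++ [x ^ 2], by simp, ?_, ?_, fun h ↦ ha1 ?_⟩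
  · rw [Ideal.ofList_append, Ideal.ofList_singleton]
    exact sup_le hle.1
      ((Ideal.span_singleton_le_iff_mem a).mpr (Ideal.pow_mem_of_mem a hle.2 2 two_pos))
  · rw [isWeaklyRegular_append_iff, isWeaklyRegular_singleton_iff]
    exact ⟨reg.1, reg.2.pow 2⟩
  have hx : x ∈ Ideal.ofList (ys ++ [x ^ 2]) := h ▸ hle.2
  rw [Ideal.ofList_append, Ideal.ofList_singleton, Submodule.mem_sup] at hx
  obtain ⟨u, hu, v, hv, huv⟩ := hx
  obtain ⟨c, rfl⟩ := Ideal.mem_span_singleton'.mp hv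
  have hmem : 1 - c * x ∈ Ideal.ofList ys := by
    have h0 := reg.2.right_eq_zero_of_smul
      (x := Submodule.Quotient.mk (1 - c * x)) ?_
    · simpa using (Submodule.Quotient.mk_eq_zero _).mp h0
    · rw [← Submodule.Quotient.mk_smul, Submodule.Quotient.mk_eq_zero]
      have : x • (1 - c * x) = u := by rw [smul_eq_mul]; linear_combination -huv
      rw [this]; simpa using hu
  rw [Ideal.eq_top_iff_one]
  simpa using a.add_mem (hle.1 hmem) (a.mul_mem_left c hle.2)

theorem Ideal.mem_associatedPrimes_of_colon {R : Type*} [CommRing R] [IsNoetherianRing R]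
    {I b P : Ideal R} (hP : P ∈ associatedPrimes R (R ⧸ (Submodule.colon I (b : Set R) : Ideal R))) :
    P ∈ associatedPrimes R (R ⧸ I) := by
  obtain ⟨hp, y, hy⟩ := Ideal.mem_associatedPrimes_quotient_iff.mp hP
  obtain ⟨s, rfl⟩ := IsNoetherian.noetherian b
  have hinf : s.inf (fun t ↦ Submodule.colon I {y * t}) = P := by
    ext r
    rw [hy, Submodule.colon_span]
    simp [Submodule.mem_colon, mul_assoc]
  obtain ⟨t, hts, ht⟩ := hp.inf_le'.mp hinf.le
  refine Ideal.mem_associatedPrimes_quotient_iff.mpr ⟨hp, y * t, fun r ↦ ⟨fun hr ↦ ?_, fun hr ↦ ?_⟩⟩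
  · have := Finset.inf_le (f := fun t ↦ Submodule.colon I {y * t}) hts (hinf.ge hr)
    exact Submodule.mem_colon_singleton.mp this
  · exact ht (Submodule.mem_colon_singleton.mpr hr)

/-- A prime containing a regular sequence and of height equal to its length is minimal over it. -/
theorem Ideal.IsPrime.mem_minimalPrimes_ofList {R : Type*} [CommRing R] [IsNoetherianRing R]
    {P : Ideal R} (hP : P.IsPrime) {rs : List R} (reg : IsWeaklyRegular R rs)
    (hle : Ideal.ofList rs ≤ P) (hh : P.height = rs.length) :
    P ∈ (Ideal.ofList rs).minimalPrimes := by
  obtain ⟨Q, hQ, hQP⟩ := Ideal.exists_minimalPrimes_le hle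
  have hQp := hQ.isPrime
  rcases hQP.eq_or_lt with rfl | hlt
  · exact hQ
  have h1 := hQp.length_le_height_of_isWeaklyRegular reg hQ.1.2
  have h2 := Ideal.height_add_one_le_of_lt_of_isPrime hlt
  have h3 : (rs.length : ℕ∞) + 1 ≤ rs.length := (add_le_add_left h1 1).trans (h2.trans hh.le)
  have : rs.length + 1 ≤ rs.length := by exact_mod_cast h3
  omega

theorem isLinkedIdeal_of_radical {R : Type*} [CommRing R] [IsNoetherianRing R] {a : Ideal R}
    (ha0 : a ≠ ⊥) (ha1 : a ≠ ⊤) (harad : a.radical = a) {rs : List R}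
    (reg : IsWeaklyRegular R rs) (hle : Ideal.ofList rs ≤ a) (hne : Ideal.ofList rs ≠ a)
    (hh : ∀ P ∈ a.minimalPrimes, P.height = rs.length) : IsLinkedIdeal a := by
  set I := Ideal.ofList rs
  let b : Ideal R := Submodule.colon I (a : Set R)
  have hb {r : R} : r ∈ b ↔ ∀ s ∈ a, r * s ∈ I := Submodule.mem_colon
  have key : ∀ P ∈ a.minimalPrimes, ∃ y ∈ b, ∀ r, r ∈ P ↔ r * y ∈ I := by
    intro P hP
    have hPI := hP.isPrime.mem_minimalPrimes_ofList reg (hle.trans hP.1.2) (hh P hP)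
    have hass : P ∈ associatedPrimes R (R ⧸ I) :=
      Module.associatedPrimes.minimalPrimes_annihilator_subset_associatedPrimes R (R ⧸ I)
        (by rwa [Ideal.annihilator_quotient])
    obtain ⟨-, y, hy⟩ := Ideal.mem_associatedPrimes_quotient_iff.mp hass
    exact ⟨y, hb.mpr fun s hs ↦ mul_comm s y ▸ (hy s).mp (hP.1.2 hs), hy⟩
  refine ⟨I, b, ha0, ha1, ?_, ?_, le_inf hle fun r hr ↦ hb.mpr fun s _ ↦ I.mul_mem_right s hr,
    ⟨rs, reg.isRegular_of_ofList_ne_top (ne_top_of_le_ne_top ha1 hle), rfl⟩, ?_, rfl⟩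
  · intro hb0
    obtain ⟨P, hP⟩ := Ideal.nonempty_minimalPrimes ha1
    obtain ⟨y, hyb, hy⟩ := key P hP
    rw [hb0, Submodule.mem_bot] at hyb
    exact hP.isPrime.ne_top ((Ideal.eq_top_iff_one P).mpr ((hy 1).mpr (by simp [hyb])))
  · intro hb1
    refine hne (hle.antisymm fun s hs ↦ ?_)
    simpa using hb.mp (hb1 ▸ Submodule.mem_top : (1 : R) ∈ b) s hs
  · refine le_antisymm (fun s hs ↦ Submodule.mem_colon.mpr fun r hr ↦ ?_) fun s hs ↦ ?_
    · simpa [mul_comm] using hb.mp hr s hs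
    · rw [← harad, ← Ideal.sInf_minimalPrimes, Submodule.mem_sInf]
      intro P hP
      obtain ⟨y, hyb, hy⟩ := key P hP
      exact (hy s).mpr (Submodule.mem_colon.mp hs y hyb)

/-- In a Cohen–Macaulay Noetherian ring, a nonzero proper radical ideal is a
linked ideal iff it is unmixed, i.e. all associated primes of `R/a` have the same height. -/
theorem stmt_16 {R : Type*} [CommRing R] [IsNoetherianRing R] (hCM : IsCohenMacaulayRing R)
    (a : Ideal R) (ha0 : a ≠ ⊥) (ha1 : a ≠ ⊤) (harad : a.radical = a) :
    IsLinkedIdeal a ↔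
      ∀ P Q : PrimeSpectrum R, P.asIdeal ∈ associatedPrimes R (R ⧸ a) →
        Q.asIdeal ∈ associatedPrimes R (R ⧸ a) → Order.height P = Order.height Q := by
  constructor
  · rintro ⟨I, b, -, -, -, -, -, ⟨rs, reg, rfl⟩, hab, -⟩ P Q hP hQ
    have key (P : PrimeSpectrum R) (hP : P.asIdeal ∈ associatedPrimes R (R ⧸ a)) :
        Order.height P = rs.length := by
      rw [hab] at hP
      rw [← PrimeSpectrum.height_eq_orderHeight]
      exact hCM.height_eq_length_of_mem_associatedPrimes reg.toIsWeaklyRegular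
        (Ideal.mem_associatedPrimes_of_colon hP)
    rw [key P hP, key Q hQ]
  · intro h
    have hmin : a.minimalPrimes ⊆ associatedPrimes R (R ⧸ a) := by
      have := Module.associatedPrimes.minimalPrimes_annihilator_subset_associatedPrimes R (R ⧸ a)
      rwa [Ideal.annihilator_quotient] at this
    obtain ⟨P₀, hP₀⟩ := Ideal.nonempty_minimalPrimes ha1
    have := hP₀.isPrime
    obtain ⟨n, hn⟩ := ENat.ne_top_iff_exists.mp (Ideal.height_ne_top (I := P₀) this.ne_top)
    have hheight : ∀ P ∈ a.minimalPrimes, P.height = n := fun P hP ↦ by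
      have := h ⟨P, hP.isPrime⟩ ⟨P₀, this⟩ (hmin hP) (hmin hP₀)
      rwa [← PrimeSpectrum.height_eq_orderHeight, ← PrimeSpectrum.height_eq_orderHeight,
        ← hn] at this
    obtain ⟨rs₀, hlen₀, hle₀, reg₀⟩ := hCM.exists_isWeaklyRegular (a := a) (n := n)
      fun Q hQ haQ ↦ by
        obtain ⟨P, hP, hPQ⟩ := Ideal.exists_minimalPrimes_le haQ
        exact (hheight P hP).ge.trans (Ideal.height_mono hPQ)
    obtain ⟨rs, hlen, hle, reg, hne⟩ := reg₀.exists_ofList_ne hle₀ ha0 ha1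
    rw [hlen₀] at hlen
    exact isLinkedIdeal_of_radical ha0 ha1 harad reg hle hne fun P hP ↦ by
      rw [hheight P hP, hlen]
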